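/- Let C_1,…,C_s be nondegenerate linear codes in F_q^m, let A be an s×h matrix over F_q of full rank s (s ≤ h), let 𝒜 ⊆ F_q^h be the linear code generated by the rows of A, and let C = [C_1,…,C_s]·A ⊆ F_q^{mh}, with coordinates of C indexed by pairs (j,ℓ), 1 ≤ j ≤ h, 1 ≤ ℓ ≤ m. If R̄ ⊆ {1,…,h} is an (r,δ)-extended recovery set for a coordinate j of 𝒜, then for every 1 ≤ ℓ ≤ m the set R̄^ℓ = { (t,ℓ) : t ∈ R̄ } is an (r,δ)-extended recovery set for the coordinate (j,ℓ) of C. Consequently, if 𝒜 is an LRC with locality (r,δ), then the matrix-product code C is an LRC with locality (r,δ). -/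

import Mathlib

/-- Minimum distance (minimum Hamming weight of a nonzero element) of a set of vectors. -/
noncomputable def dminS {F : Type*} [DecidableEq F] [Zero F] {n : Type*} [Fintype n]
    (C : Set (n → F)) : ℕ :=
  sInf { w | ∃ c ∈ C, c ≠ 0 ∧ hammingNorm c = w }

/-- Euclidean dual of a set of vectors. -/
def dualE {F : Type*} [Field F] {n : Type*} [Fintype n] (C : Set (n → F)) : Set (n → F) :=
  { x | ∀ c ∈ C, ∑ j, x j * c j = 0 }

/-- Hermitian dual (with respect to x ↦ x^q) of a set of vectors over F_{q^2}. -/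
def dualH {F : Type*} [Field F] {n : Type*} [Fintype n] (q : ℕ) (C : Set (n → F)) :
    Set (n → F) :=
  { x | ∀ c ∈ C, ∑ j, x j * (c j) ^ q = 0 }

/-- The matrix-product code `[C_1,…,C_s]·A` as a set of vectors indexed by `Fin h × Fin m`. -/
def mpcSet {F : Type*} [Field F] {s h m : ℕ}
    (C : Fin s → Set (Fin m → F)) (A : Matrix (Fin s) (Fin h) F) :
    Set (Fin h × Fin m → F) :=
  { p | ∃ v : Fin s → Fin m → F, (∀ i, v i ∈ C i) ∧ ∀ x, p x = ∑ i, A i x.1 * v i x.2 }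

/-- A matrix is non-singular by columns. -/
def IsNSC {F : Type*} [Field F] {s h : ℕ} (A : Matrix (Fin s) (Fin h) F) : Prop :=
  ∀ (i : ℕ) (hi : i ≤ s), 0 < i → ∀ c : Fin i → Fin h, StrictMono c →
    (Matrix.of fun r t : Fin i => A (Fin.castLE hi r) (c t)).det ≠ 0

/-- Punctured code: projection of `C` onto the coordinates in `R`. -/
def punct {F : Type*} {n : Type*} (C : Set (n → F)) (R : Finset n) :
    Set ({x // x ∈ R} → F) :=
  (fun c (t : {x // x ∈ R}) => c t.1) '' C

/-- `R` is an (r,δ)-extended recovery set for coordinate `i` of the code `C`. -/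
def IsRecSet {F : Type*} [DecidableEq F] [Zero F] {n : Type*} [Fintype n]
    (C : Set (n → F)) (r δ : ℕ) (i : n) (R : Finset n) : Prop :=
  i ∈ R ∧ R.card ≤ r + δ - 1 ∧ δ ≤ dminS (punct C R)

/-- `C` is a locally recoverable code with locality (r,δ). -/
def IsLRC {F : Type*} [DecidableEq F] [Zero F] {n : Type*} [Fintype n]
    (C : Set (n → F)) (r δ : ℕ) : Prop :=
  ∀ i : n, ∃ R : Finset n, IsRecSet C r δ i R

/-- `wv α i` is the evaluation of the monomial `X^(i-1)` at all points of the field,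
enumerated by `α`. -/
def wv {F : Type*} [Field F] {q : ℕ} (α : Fin q ≃ F) (i : ℕ) : Fin q → F :=
  fun j => (α j) ^ (i - 1)

/-- `av α p i` : the vectors `a_i`, with `a_i = w_i` for `i < q` and
`a_q = w_q + ((p-1)/2) • w_1`. -/
def av {F : Type*} [Field F] {q : ℕ} (α : Fin q ≃ F) (p : ℕ) (i : ℕ) : Fin q → F :=
  if i = q then wv α q + (((p - 1) / 2 : ℕ) : F) • wv α 1 else wv α i

/-- The square matrix whose rows are `a_1, …, a_q`. -/
def Adot {F : Type*} [Field F] {q : ℕ} (α : Fin q ≃ F) (p : ℕ) : Matrix (Fin q) (Fin q) F :=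
  Matrix.of fun r j => av α p ((r : ℕ) + 1) j

/-- recovery structure of a matrix-product code inherited from the code `𝒜`
generated by the rows of `A`. -/
theorem stmt17 {F : Type*} [Field F] [Fintype F] [DecidableEq F] {s h m : ℕ}
    (hs : 0 < s) (hsh : s ≤ h)
    (A : Matrix (Fin s) (Fin h) F) (hA : A.rank = s)
    (C : Fin s → Submodule F (Fin m → F))
    (hnd : ∀ (i : Fin s) (ℓ : Fin m), ∃ c ∈ C i, c ℓ ≠ 0) (r δ : ℕ) :
    (∀ (R : Finset (Fin h)) (j : Fin h),
      IsRecSet ((Submodule.span F (Set.range fun i : Fin s => fun t => A i t) :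
          Submodule F (Fin h → F)) : Set (Fin h → F)) r δ j R →
      ∀ ℓ : Fin m,
        IsRecSet (mpcSet (fun i => (C i : Set (Fin m → F))) A) r δ (j, ℓ)
          (R.image fun t => (t, ℓ))) ∧
    (IsLRC ((Submodule.span F (Set.range fun i : Fin s => fun t => A i t) :
        Submodule F (Fin h → F)) : Set (Fin h → F)) r δ →
      IsLRC (mpcSet (fun i => (C i : Set (Fin m → F))) A) r δ) := by
  have key : ∀ (R : Finset (Fin h)) (j : Fin h),
      IsRecSet ((Submodule.span F (Set.range fun i : Fin s => fun t => A i t) :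
          Submodule F (Fin h → F)) : Set (Fin h → F)) r δ j R →
      ∀ ℓ : Fin m,
        IsRecSet (mpcSet (fun i => (C i : Set (Fin m → F))) A) r δ (j, ℓ)
          (R.image fun t => (t, ℓ)) := by
    rintro R j ⟨hj, hcard, hd⟩ ℓ
    refine ⟨Finset.mem_image_of_mem _ hj, Finset.card_image_le.trans hcard, ?_⟩
    rcases Nat.eq_zero_or_pos δ with h0 | hpos
    · omega
    have hne := Nat.nonempty_of_pos_sInf (lt_of_lt_of_le hpos hd)
    obtain ⟨w, c, ⟨a, ha, rfl⟩, hc0, -⟩ := hne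
    have hex : ∃ i : Fin s, ∃ t ∈ R, A i t ≠ 0 := by
      by_contra! hcon
      apply hc0
      have : ∀ x ∈ Submodule.span F (Set.range fun i : Fin s => fun t => A i t),
          ∀ t ∈ R, x t = 0 := by
        intro x hx
        induction hx using Submodule.span_induction with
        | mem x hx => obtain ⟨i, rfl⟩ := hx; exact hcon i
        | zero => simp
        | add x y _ _ hx hy => intro t ht; simp [hx t ht, hy t ht]
        | smul k x _ hx => intro t ht; simp [hx t ht]
      funext t
      exact this a ha t.1 t.2
    obtain ⟨i, t, ht, hit⟩ := hex
    obtain ⟨c, hc, hcl⟩ := hnd i ℓ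
    refine le_csInf ?_ ?_
    · refine ⟨_, _, ⟨fun x => ∑ k, A k x.1 * (Pi.single i c : Fin s → Fin m → F) k x.2,
        ⟨Pi.single i c, ?_, fun x => rfl⟩, rfl⟩, ?_, rfl⟩
      · intro k
        by_cases hk : k = i
        · subst hk; simpa using hc
        · simp [Pi.single_eq_of_ne hk]
      · intro hz
        have := congrFun hz ⟨(t, ℓ), Finset.mem_image_of_mem _ ht⟩
        simp only [Pi.zero_apply] at this
        rw [Finset.sum_eq_single i] at this
        · simp [hit, hcl] at this
        · intro k _ hk
          simp [Pi.single_eq_of_ne hk]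
        · simp
    · rintro w ⟨_, ⟨p, ⟨v, hv, hp⟩, rfl⟩, hp0, rfl⟩
      let b : Fin h → F := ∑ k, v k ℓ • (fun t => A k t)
      have hb : ∀ t, b t = p (t, ℓ) := by
        intro t
        rw [hp]
        simp [b, mul_comm]
      have hbm : b ∈ Submodule.span F (Set.range fun i : Fin s => fun t => A i t) :=
        Submodule.sum_mem _ fun k _ => Submodule.smul_mem _ _ (Submodule.subset_span ⟨k, rfl⟩)
      refine le_trans (hd.trans (Nat.sInf_le (m := hammingNorm fun t : {x // x ∈ R} => b t.1)
        ⟨_, ⟨b, hbm, rfl⟩, ?_, rfl⟩)) ?_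
      · intro hz
        apply hp0
        funext x
        obtain ⟨x, hx⟩ := x
        obtain ⟨t, ht, rfl⟩ := Finset.mem_image.1 hx
        have := congrFun hz ⟨t, ht⟩
        simpa [hb] using this
      · unfold hammingNorm
        refine Finset.card_le_card_of_injOn
          (fun t => ⟨(t.1, ℓ), Finset.mem_image_of_mem _ t.2⟩) ?_ ?_
        · intro t ht
          simpa [hb] using ht
        · intro t _ u _ htu
          exact Subtype.ext (congrArg (fun z => z.1.1) htu)
  refine ⟨key, ?_⟩
  rintro hL ⟨j, ℓ⟩
  obtain ⟨R, hR⟩ := hL j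
  exact ⟨_, key R j hR ℓ⟩
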